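/- arXiv:2007.13321 — 3 statements merged into one kernel-verified Lean document; each statement's English description precedes it below -/
import Mathlib

section
/- Let A, M be n×n complex matrices and Y an m×n complex matrix such that Y·A = 0 (the m×n zero matrix) and M is Hermitian positive definite, and set C = Y·M. If Λ ∈ ℂ, ξ ∈ ℂⁿ and ζ ∈ ℂᵐ satisfy A·ξ + Cᴴ·ζ = Λ·M·ξ and C·ξ = 0, then Cᴴ·ζ = 0 and consequently A·ξ = Λ·M·ξ. -/
open Matrix
open scoped ComplexOrder

/-- If `Y * A = 0`, `M` is Hermitian positive definite, `C = Y * M`, and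
`A ξ + Cᴴ ζ = Λ • M ξ` with `C ξ = 0`, then `Cᴴ ζ = 0` and hence `A ξ = Λ • M ξ`:
the augmented method introduces no spurious modes. -/
theorem augmented_no_spurious_modes
    {m n : ℕ} (A M : Matrix (Fin n) (Fin n) ℂ) (Y : Matrix (Fin m) (Fin n) ℂ)
    (hYA : Y * A = 0) (hM : M.PosDef)
    (C : Matrix (Fin m) (Fin n) ℂ) (hC : C = Y * M)
    (Λ : ℂ) (ξ : Fin n → ℂ) (ζ : Fin m → ℂ)
    (heig : A *ᵥ ξ + Cᴴ *ᵥ ζ = Λ • (M *ᵥ ξ))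
    (hcon : C *ᵥ ξ = 0) :
    Cᴴ *ᵥ ζ = 0 ∧ A *ᵥ ξ = Λ • (M *ᵥ ξ) := by
  have hCH : Cᴴ *ᵥ ζ = M *ᵥ (Yᴴ *ᵥ ζ) := by
    rw [hC, conjTranspose_mul, hM.isHermitian.eq, mulVec_mulVec]
  have hYC : Y *ᵥ (Cᴴ *ᵥ ζ) = 0 := by
    have h := congrArg (Y *ᵥ ·) heig
    simpa [mulVec_add, mulVec_smul, mulVec_mulVec, hYA, ← hC, hcon] using h
  have hquad : star (Yᴴ *ᵥ ζ) ⬝ᵥ (M *ᵥ (Yᴴ *ᵥ ζ)) = 0 := by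
    rw [star_mulVec, conjTranspose_conjTranspose, ← dotProduct_mulVec, ← hCH, hYC,
      dotProduct_zero]
  have hY : Yᴴ *ᵥ ζ = 0 := by
    by_contra hne
    exact (hM.dotProduct_mulVec_pos hne).ne' hquad
  have hzero : Cᴴ *ᵥ ζ = 0 := by rw [hCH, hY, mulVec_zero]
  exact ⟨hzero, by simpa [hzero] using heig⟩
end

section
/- Let A, M be n×n complex matrices and Y an m×n complex matrix such that Y·A = 0 and M is Hermitian positive definite, and set C = Y·M. Let Q be an n×r complex matrix whose column span equals the null space {ξ ∈ ℂⁿ : C·ξ = 0} of C. If y ∈ ℂʳ and Λ ∈ ℂ satisfy (Qᴴ·A·Q)·y = Λ·(Qᴴ·M·Q)·y, then the vector ξ = Q·y satisfies A·ξ = Λ·M·ξ and C·ξ = 0. -/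
open Matrix
open scoped ComplexOrder

/-- Projection method produces exact eigenpairs of the constrained problem:
if `Y * A = 0`, `M` is Hermitian positive definite, `C = Y * M`, the column span of
`Q` equals the null space of `C`, and `(Qᴴ A Q) y = Λ • (Qᴴ M Q) y`, then `ξ = Q y`
satisfies `A ξ = Λ • M ξ` and `C ξ = 0`. -/
theorem projection_method_exact
    {m n r : ℕ} (A M : Matrix (Fin n) (Fin n) ℂ) (Y : Matrix (Fin m) (Fin n) ℂ)
    (hYA : Y * A = 0) (hM : M.PosDef)
    (C : Matrix (Fin m) (Fin n) ℂ) (hC : C = Y * M)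
    (Q : Matrix (Fin n) (Fin r) ℂ)
    (hQ : Submodule.span ℂ (Set.range Qᵀ) = LinearMap.ker C.mulVecLin)
    (y : Fin r → ℂ) (Λ : ℂ)
    (heig : (Qᴴ * A * Q) *ᵥ y = Λ • ((Qᴴ * M * Q) *ᵥ y))
    (ξ : Fin n → ℂ) (hξ : ξ = Q *ᵥ y) :
    A *ᵥ ξ = Λ • (M *ᵥ ξ) ∧ C *ᵥ ξ = 0 := by
  have hrange : LinearMap.range Q.mulVecLin = LinearMap.ker C.mulVecLin :=
    (range_mulVecLin Q).trans hQ
  have hCξ : C *ᵥ ξ = 0 := by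
    have h : Q.mulVecLin y ∈ LinearMap.ker C.mulVecLin := hrange ▸ ⟨y, rfl⟩
    simpa [hξ] using h
  refine ⟨?_, hCξ⟩
  set ρ : Fin n → ℂ := A *ᵥ ξ - Λ • (M *ᵥ ξ) with hρ
  have hQρ : Qᴴ *ᵥ ρ = 0 := by
    rw [hρ, mulVec_sub, mulVec_smul, hξ, sub_eq_zero]
    simpa [mulVec_mulVec, Matrix.mul_assoc] using heig
  have hYρ : Y *ᵥ ρ = 0 := by
    rw [hρ, mulVec_sub, mulVec_smul, mulVec_mulVec, mulVec_mulVec, hYA, ← hC, hCξ]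
    simp
  have hdet : IsUnit M.det := (isUnit_iff_isUnit_det M).mp hM.isUnit
  obtain ⟨w, hw⟩ : ∃ w, M *ᵥ w = ρ :=
    ⟨M⁻¹ *ᵥ ρ, by rw [mulVec_mulVec, mul_nonsing_inv _ hdet, one_mulVec]⟩
  obtain ⟨z, hz⟩ : w ∈ LinearMap.range Q.mulVecLin := by
    rw [hrange, LinearMap.mem_ker, mulVecLin_apply, hC, ← mulVec_mulVec, hw, hYρ]
  rw [mulVecLin_apply] at hz
  have hwMw : star w ⬝ᵥ (M *ᵥ w) = 0 := by
    rw [hw, ← hz, star_mulVec, ← dotProduct_mulVec, hQρ, dotProduct_zero]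
  have hw0 : w = 0 := by
    by_contra hne
    exact (hM.dotProduct_mulVec_pos hne).ne' hwMw
  rw [← sub_eq_zero, ← hρ, ← hw, hw0, mulVec_zero]
end

section
/- Let A, M be n×n complex matrices and Y an m×n complex matrix such that Y·A = 0, M is Hermitian positive definite, and the null space {ζ ∈ ℂᵐ : Yᴴ·ζ = 0} equals the span of the all-ones vector β = (1, …, 1)ᵀ ∈ ℂᵐ; set C = Y·M. If Λ ∈ ℂ, ξ ∈ ℂⁿ and ζ ∈ ℂᵐ satisfy A·ξ + Cᴴ·ζ = Λ·M·ξ and C·ξ = 0, then there exists c ∈ ℂ such that ζ = c·β, i.e., all entries of ζ are equal. -/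
open Matrix
open scoped ComplexOrder

/-- If `Y * A = 0`, `M` is Hermitian positive definite, the null space of `Yᴴ` is the
span of the all-ones vector `β`, and `C = Y * M`, then the Lagrange-multiplier part `ζ`
of every eigenvector of the augmented problem `A ξ + Cᴴ ζ = Λ • M ξ`, `C ξ = 0` is a
constant vector: `ζ = c • β` for some `c ∈ ℂ`. -/
theorem lagrange_multiplier_is_constant
    {m n : ℕ} (A M : Matrix (Fin n) (Fin n) ℂ) (Y : Matrix (Fin m) (Fin n) ℂ)
    (hYA : Y * A = 0) (hM : M.PosDef)
    (hker : LinearMap.ker (Yᴴ).mulVecLin =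
      Submodule.span ℂ {(fun _ => 1 : Fin m → ℂ)})
    (C : Matrix (Fin m) (Fin n) ℂ) (hC : C = Y * M)
    (Λ : ℂ) (ξ : Fin n → ℂ) (ζ : Fin m → ℂ)
    (heig : A *ᵥ ξ + Cᴴ *ᵥ ζ = Λ • (M *ᵥ ξ))
    (hcon : C *ᵥ ξ = 0) :
    ∃ c : ℂ, ζ = c • (fun _ => 1 : Fin m → ℂ) := by
  subst hC
  have hY : Y *ᵥ (M *ᵥ (Yᴴ *ᵥ ζ)) = 0 := by
    have h := congrArg (Y *ᵥ ·) heig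
    simpa only [mulVec_add, mulVec_smul, mulVec_mulVec, hYA, hcon, zero_mulVec, zero_add,
      smul_zero, conjTranspose_mul, hM.isHermitian.eq, Matrix.mul_assoc] using h
  have hζ : Yᴴ *ᵥ ζ = 0 := by
    by_contra hne
    refine (hM.dotProduct_mulVec_pos hne).ne' ?_
    rw [star_mulVec, conjTranspose_conjTranspose, ← dotProduct_mulVec, hY, dotProduct_zero]
  have hmem : ζ ∈ LinearMap.ker (Yᴴ).mulVecLin := by simpa using hζ
  rw [hker, Submodule.mem_span_singleton] at hmem
  obtain ⟨c, hc⟩ := hmem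
  exact ⟨c, hc.symm⟩
end
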